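/- Let X be a spectral space. The following are equivalent: (i) qcop(X) is a Stone algebra; (ii) for every U ∈ qcop(X) the closure ↑U of U is open; (iii) X^min is patch closed and for all x, y, z ∈ X with y ≤ x and z ≤ x there is u ∈ X with u ≤ y and u ≤ z (equivalently, ↑(D ∩ E) = ↑D ∩ ↑E for any two down-sets D, E of X); (iv) X^min is patch closed and every point of X has a unique minimal generalization, i.e. for each x ∈ X there is a unique y ∈ X^min with y ≤ x; (v) every point of X has a unique minimal generalization and the map X → X sending x to its unique minimal generalization is a spectral map (continuous with preimages of compact open sets compact open); (vi) there is a continuous retraction X → X^min of the inclusion map X^min ↪ X. -/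

import Mathlib

open Set Topology

namespace PCF

variable {X : Type*}

/-- The compact open subsets of a topological space. -/
def qcop (t : TopologicalSpace X) : Set (Set X) :=
  {U | @IsOpen X t U ∧ @IsCompact X t U}

/-- The complements of the compact open subsets. -/
def qccl (t : TopologicalSpace X) : Set (Set X) :=
  {C | ∃ U ∈ qcop t, C = Uᶜ}

/-- The Boolean algebra of subsets generated by the compact open sets:
the constructible sets. -/
def Constructible (t : TopologicalSpace X) : Set (Set X) :=
  ⋂₀ {B : Set (Set X) | qcop t ⊆ B ∧ (∀ s ∈ B, sᶜ ∈ B) ∧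
        (∀ s ∈ B, ∀ u ∈ B, s ∪ u ∈ B) ∧ (∅ : Set X) ∈ B}

/-- The patch topology: generated by the compact open sets together with their
complements (equivalently, by the constructible sets). -/
def patchTop (t : TopologicalSpace X) : TopologicalSpace X :=
  TopologicalSpace.generateFrom (qcop t ∪ qccl t)

/-- The inverse topology, with the complements of compact opens as a basis of opens. -/
def invTop (t : TopologicalSpace X) : TopologicalSpace X :=
  TopologicalSpace.generateFrom (qccl t)

/-- The specialization order: `x ≤ y` iff `y` is in the closure of `{x}`. -/
def specLE (t : TopologicalSpace X) (x y : X) : Prop := y ∈ @closure X t {x}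

/-- Minimal points for the specialization order. -/
def minPts (t : TopologicalSpace X) : Set X := {x | ∀ y, specLE t y x → y = x}

/-- Maximal points for the specialization order. -/
def maxPts (t : TopologicalSpace X) : Set X := {x | ∀ y, specLE t x y → y = x}

/-- Minimal points of a subset `S`, for the induced specialization order. -/
def minPtsIn (t : TopologicalSpace X) (S : Set X) : Set X :=
  {x | x ∈ S ∧ ∀ y ∈ S, specLE t y x → y = x}

/-- Maximal points of a subset `S`, for the induced specialization order. -/
def maxPtsIn (t : TopologicalSpace X) (S : Set X) : Set X :=
  {x | x ∈ S ∧ ∀ y ∈ S, specLE t x y → y = x}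

/-- The down-set (set of generalizations) generated by `S`. -/
def downset (t : TopologicalSpace X) (S : Set X) : Set X :=
  {x | ∃ s ∈ S, specLE t x s}

/-- The up-set (set of specializations) generated by `S`. -/
def upset (t : TopologicalSpace X) (S : Set X) : Set X :=
  {x | ∃ s ∈ S, specLE t s x}

/-- A topology is spectral if the space is compact, sober (quasi-sober and T0),
the compact opens form a basis, and the compact opens are closed under
finite intersections. -/
def IsSpectral (t : TopologicalSpace X) : Prop :=
  @CompactSpace X t ∧ @QuasiSober X t ∧ @T0Space X t ∧
  @TopologicalSpace.IsTopologicalBasis X t (qcop t) ∧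
  ∀ U ∈ qcop t, ∀ V ∈ qcop t, U ∩ V ∈ qcop t

/-- A Boolean space: compact, Hausdorff and zero-dimensional. -/
def IsBooleanSpace (t : TopologicalSpace X) : Prop :=
  @CompactSpace X t ∧ @T2Space X t ∧
  @TopologicalSpace.IsTopologicalBasis X t {U | @IsClopen X t U}

/-- `V` is the pseudocomplement of `U` in the lattice of sets `L` (ordered by
inclusion, with meet given by intersection and bottom element `∅`): `V` is the
largest element of `L` disjoint from `U`. -/
def IsPseudoCompl (L : Set (Set X)) (U V : Set X) : Prop :=
  V ∈ L ∧ U ∩ V = ∅ ∧ ∀ W ∈ L, U ∩ W = ∅ → W ⊆ V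

/-- The lattice of sets `L` is pseudocomplemented: every element has a
pseudocomplement. -/
def Pseudocomplemented (L : Set (Set X)) : Prop :=
  ∀ U ∈ L, ∃ V, IsPseudoCompl L U V

/-- The lattice of sets `L` is a Stone algebra: it is pseudocomplemented and
`U* ∪ U** = ⊤` for every `U`. -/
def StoneAlgebra (L : Set (Set X)) : Prop :=
  Pseudocomplemented L ∧
  ∀ U ∈ L, ∀ V W : Set X, IsPseudoCompl L U V → IsPseudoCompl L V W → V ∪ W = univ

/-- The lattice of sets `L` is a Heyting algebra: for all `U, V ∈ L` there is a
largest `W ∈ L` with `U ∩ W ⊆ V`. -/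
def HeytingAlg (L : Set (Set X)) : Prop :=
  ∀ U ∈ L, ∀ V ∈ L, ∃ W ∈ L, U ∩ W ⊆ V ∧ ∀ W' ∈ L, U ∩ W' ⊆ V → W' ⊆ W

/-- A PC-space: the lattice of compact open sets is pseudocomplemented. -/
def IsPCSpace (t : TopologicalSpace X) : Prop := Pseudocomplemented (qcop t)

/-- An Esakia space: the closure of every constructible set is constructible. -/
def IsEsakia (t : TopologicalSpace X) : Prop :=
  ∀ S ∈ Constructible t, @closure X t S ∈ Constructible t

/-- A spectral root system: the closure of every point is a specialization chain. -/
def IsRootSystem (t : TopologicalSpace X) : Prop :=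
  ∀ x : X, IsChain (specLE t) (@closure X t {x})

/-- A spectral forest: the inverse space is a spectral root system. -/
def IsForest (t : TopologicalSpace X) : Prop := IsRootSystem (invTop t)

/-- A stranded space: the specialization poset is a disjoint union of chains, i.e.
the set of points comparable with any fixed point is a chain. -/
def Stranded (t : TopologicalSpace X) : Prop :=
  ∀ x : X, IsChain (specLE t) {y | specLE t x y ∨ specLE t y x}

end PCF

open PCF

section Rings

variable (T : Type*) [TopologicalSpace T]

/-- The zero set of a continuous real-valued function. -/
def zeroSet (f : ContinuousMap T ℝ) : Set T := {t | f t = 0}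

/-- The lattice of cozero sets of a topological space. -/
def Coz : Set (Set T) := {U | ∃ f : ContinuousMap T ℝ, U = {t | f t ≠ 0}}

/-- A z-ideal of the ring `C(T)` of continuous real-valued functions. -/
def IsZIdeal (I : Ideal (ContinuousMap T ℝ)) : Prop :=
  ∀ f ∈ I, ∀ g : ContinuousMap T ℝ, zeroSet T f ⊆ zeroSet T g → g ∈ I

/-- The prime z-ideals, as a subset of the prime spectrum of `C(T)`. -/
def zSpec : Set (PrimeSpectrum (ContinuousMap T ℝ)) :=
  {p | IsZIdeal T p.asIdeal}

/-- A space is basically disconnected if the closure of every cozero set is open. -/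
def BasicallyDisconnected : Prop :=
  ∀ f : ContinuousMap T ℝ, IsOpen (closure {t | f t ≠ 0})

/-- The Zariski topology on the prime spectrum of `C(T)`. -/
def specTop : TopologicalSpace (PrimeSpectrum (ContinuousMap T ℝ)) := inferInstance

/-- The subspace topology on the set of prime z-ideals. -/
def zTop : TopologicalSpace ↥(zSpec T) := inferInstance

end Rings

/-- The subspace topology on a subset. -/
def subTop {Y : Type*} [TopologicalSpace Y] (X : Set Y) : TopologicalSpace ↥X :=
  inferInstance

namespace PCF

theorem IsPseudoCompl.unique {Y : Type*} {L : Set (Set Y)} {U V W : Set Y} (hV : IsPseudoCompl L U V)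
    (hW : IsPseudoCompl L U W) : V = W :=
  Subset.antisymm (hW.2.2 V hV.1 hV.2.1) (hV.2.2 W hW.1 hW.2.1)

variable {X : Type*} [t : TopologicalSpace X]

theorem IsSpectral.spectralSpace (hX : IsSpectral t) : SpectralSpace X where
  __ := hX.1
  __ := hX.2.1
  __ := hX.2.2.1
  isTopologicalBasis := hX.2.2.2.1
  inter_isCompact U V hU hU' hV hV' := (hX.2.2.2.2 U ⟨hU, hU'⟩ V ⟨hV, hV'⟩).2

theorem specLE_iff_specializes {x y : X} : specLE t x y ↔ x ⤳ y :=
  specializes_iff_mem_closure.symm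

theorem specLE_trans {x y z : X} (hxy : specLE t x y) (hyz : specLE t y z) : specLE t x z :=
  specLE_iff_specializes.2 <|
    (specLE_iff_specializes.1 hxy).trans (specLE_iff_specializes.1 hyz)

theorem specLE.mem_of_isOpen {x y : X} {U : Set X} (h : specLE t x y) (hU : IsOpen U)
    (hy : y ∈ U) : x ∈ U :=
  (specLE_iff_specializes.1 h).mem_open hU hy

theorem specLE.mem_closure {x y : X} {S : Set X} (h : specLE t x y) (hx : x ∈ S) :
    y ∈ closure S :=
  closure_mono (singleton_subset_iff.2 hx) h

theorem patchTop_eq_constructibleTopology : patchTop t = constructibleTopology X := by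
  unfold patchTop constructibleTopology
  congr 1
  ext s
  constructor
  · rintro (h | ⟨U, hU, rfl⟩)
    · exact Or.inl h
    · exact Or.inr ⟨hU.1.isClosed_compl, by simpa using hU.2⟩
  · rintro (h | h)
    · exact Or.inl h
    · exact Or.inr ⟨sᶜ, ⟨h.1.isOpen_compl, h.2⟩, (compl_compl s).symm⟩

theorem isOpen_patchTop_of_mem_qcop {U : Set X} (hU : U ∈ qcop t) : IsOpen[patchTop t] U :=
  TopologicalSpace.isOpen_generateFrom_of_mem (Or.inl hU)

theorem isClosed_patchTop_of_mem_qcop {U : Set X} (hU : U ∈ qcop t) :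
    IsClosed[patchTop t] U :=
  (@isOpen_compl_iff X U (patchTop t)).1
    (TopologicalSpace.isOpen_generateFrom_of_mem (Or.inr ⟨U, hU, rfl⟩))

theorem compactSpace_patchTop [SpectralSpace X] : @CompactSpace X (patchTop t) := by
  rw [patchTop_eq_constructibleTopology]
  exact @Function.Surjective.compactSpace (WithConstructibleTopology X) X _
    (constructibleTopology X) _ (WithTopology.continuous_ofTopology _) inferInstance
    (WithTopology.ofTopology_surjective _)

theorem exists_qcop_subset [SpectralSpace X] {x : X} {O : Set X} (hO : IsOpen O) (hx : x ∈ O) :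
    ∃ U ∈ qcop t, x ∈ U ∧ U ⊆ O :=
  PrespectralSpace.isTopologicalBasis.exists_subset_of_mem_open hx hO

theorem IsClopen.mem_qcop [CompactSpace X] {U : Set X} (hU : IsClopen U) : U ∈ qcop t :=
  ⟨hU.2, hU.1.isCompact⟩

/-- The closure of a patch closed set consists of the specializations of its points. -/
theorem closure_eq_upset [SpectralSpace X] {K : Set X} (hK : IsClosed[patchTop t] K) :
    closure K = upset t K := by
  refine Subset.antisymm (fun x hx ↦ ?_) fun x ⟨k, hk, hkx⟩ ↦ hkx.mem_closure hk
  have hKc : @IsCompact X (patchTop t) K :=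
    @IsClosed.isCompact X (patchTop t) K compactSpace_patchTop hK
  obtain ⟨k, hkK, hk⟩ := @IsCompact.inter_iInter_nonempty X (patchTop t) K
    {V : Set X // V ∈ qcop t ∧ x ∈ V} hKc (fun V ↦ V.1)
    (fun V ↦ isClosed_patchTop_of_mem_qcop V.2.1) (fun u ↦ by
      rw [inter_comm]
      exact mem_closure_iff.1 hx _ (isOpen_biInter_finset fun V _ ↦ V.2.1.1)
        (mem_iInter₂.2 fun V _ ↦ V.2.2))
  refine ⟨k, hkK, specLE_iff_specializes.2 (specializes_iff_forall_open.2 fun O hO hxO ↦ ?_)⟩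
  obtain ⟨V, hV, hxV, hVO⟩ := exists_qcop_subset hO hxO
  exact hVO (mem_iInter.1 hk ⟨V, hV, hxV⟩)

theorem mem_of_mem_minPts_of_mem_closure [SpectralSpace X] {x : X} {U : Set X}
    (hx : x ∈ minPts t) (hU : U ∈ qcop t) (hxU : x ∈ closure U) : x ∈ U := by
  rw [closure_eq_upset (isClosed_patchTop_of_mem_qcop hU)] at hxU
  obtain ⟨k, hk, hkx⟩ := hxU
  exact hx k hkx ▸ hk

theorem specLE_antisymm [T0Space X] {x y : X} (hxy : specLE t x y) (hyx : specLE t y x) :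
    x = y :=
  ((specLE_iff_specializes.1 hxy).antisymm (specLE_iff_specializes.1 hyx)).eq

/-- Every point of a sober space has a minimal generalization. -/
theorem exists_mem_minPts_specLE [QuasiSober X] [T0Space X] (x : X) :
    ∃ y ∈ minPts t, specLE t y x := by
  obtain ⟨Z, hZ, hxZ⟩ :=
    exists_mem_irreducibleComponents_subset_of_isIrreducible {x} isIrreducible_singleton
  have hgen := hZ.1.isGenericPoint_genericPoint (isClosed_of_mem_irreducibleComponents Z hZ)
  refine ⟨hZ.1.genericPoint, fun y hy ↦ ?_, ?_⟩
  · refine specLE_antisymm hy ?_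
    have hle : Z ⊆ closure {y} := by
      rw [← hgen.def]
      exact closure_minimal (singleton_subset_iff.2 hy) isClosed_closure
    have := hZ.2 isIrreducible_singleton.closure hle (subset_closure (mem_singleton y))
    rwa [← hgen.def] at this
  · have := singleton_subset_iff.1 hxZ
    rwa [← hgen.def] at this

theorem minPts_eq_iInter [SpectralSpace X] :
    minPts t = ⋂ U ∈ qcop t, U ∪ (closure U)ᶜ := by
  ext x
  simp only [mem_iInter, mem_union, mem_compl_iff]
  refine ⟨fun hx U hU ↦ ?_, fun hx y hyx ↦ ?_⟩
  · exact or_iff_not_imp_right.2 fun hxU ↦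
      mem_of_mem_minPts_of_mem_closure hx hU (not_not.1 hxU)
  · refine specLE_antisymm hyx (specLE_iff_specializes.2
      (specializes_iff_forall_open.2 fun O hO hyO ↦ ?_))
    obtain ⟨U, hU, hyU, hUO⟩ := exists_qcop_subset hO hyO
    exact hUO ((hx U hU).resolve_right (not_not.2 (hyx.mem_closure hyU)))

theorem compl_closure_isPseudoCompl {U : Set X} (h : (closure U)ᶜ ∈ qcop t) :
    IsPseudoCompl (qcop t) U (closure U)ᶜ :=
  ⟨h, disjoint_iff_inter_eq_empty.1 (disjoint_compl_right.mono_left subset_closure),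
    fun _ hW hUW ↦ subset_compl_iff_disjoint_left.2
      ((disjoint_iff_inter_eq_empty.2 hUW).closure_left hW.1)⟩

theorem IsPseudoCompl.compl_eq_closure [SpectralSpace X] {U V : Set X}
    (h : IsPseudoCompl (qcop t) U V) : Vᶜ = closure U := by
  refine Subset.antisymm (compl_subset_comm.1 fun x hx ↦ ?_)
    (closure_minimal (subset_compl_iff_disjoint_right.2 (disjoint_iff_inter_eq_empty.2 h.2.1))
      h.1.1.isClosed_compl)
  obtain ⟨W, hW, hxW, hWU⟩ := exists_qcop_subset isClosed_closure.isOpen_compl hx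
  refine h.2.2 W hW (disjoint_iff_inter_eq_empty.1 ?_) hxW
  exact (subset_compl_iff_disjoint_left.1 hWU).mono_left subset_closure

theorem StoneAlgebra.isOpen_closure [SpectralSpace X] (h : StoneAlgebra (qcop t)) {U : Set X}
    (hU : U ∈ qcop t) : IsOpen (closure U) := by
  obtain ⟨V, hV⟩ := h.1 U hU
  obtain ⟨W, hW⟩ := h.1 V hV.1
  have hVW : Vᶜ = W := IsCompl.compl_eq
    ⟨disjoint_iff_inter_eq_empty.2 hW.2.1, codisjoint_iff.2 (h.2 U hU V W hV hW)⟩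
  rw [← hV.compl_eq_closure, hVW]
  exact hW.1.1

theorem compl_closure_mem_qcop_of_isOpen_closure [CompactSpace X]
    (h : ∀ U ∈ qcop t, IsOpen (closure U)) {U : Set X} (hU : U ∈ qcop t) : (closure U)ᶜ ∈ qcop t :=
  IsClopen.mem_qcop (IsClopen.compl ⟨isClosed_closure, h U hU⟩)

theorem stoneAlgebra_of_isOpen_closure [CompactSpace X]
    (h : ∀ U ∈ qcop t, IsOpen (closure U)) : StoneAlgebra (qcop t) := by
  refine ⟨fun U hU ↦ ⟨_, compl_closure_isPseudoCompl
    (compl_closure_mem_qcop_of_isOpen_closure h hU)⟩, fun U hU V W hV hW ↦ ?_⟩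
  have hVU := hV.unique
    (compl_closure_isPseudoCompl (compl_closure_mem_qcop_of_isOpen_closure h hU))
  have hWV := hW.unique
    (compl_closure_isPseudoCompl (compl_closure_mem_qcop_of_isOpen_closure h hV.1))
  have hVc : closure V = V := by
    rw [hVU]
    exact (h U hU).isClosed_compl.closure_eq
  rw [hWV, hVc, union_compl_self]

theorem isClosed_minPts_of_isOpen_closure [SpectralSpace X]
    (h : ∀ U ∈ qcop t, IsOpen (closure U)) :
    IsClosed[patchTop t] (minPts t) := by
  rw [minPts_eq_iInter]
  exact @isClosed_biInter _ _ (patchTop t) _ _ fun U hU ↦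
    @IsClosed.union _ _ _ (patchTop t) (isClosed_patchTop_of_mem_qcop hU)
      (isClosed_patchTop_of_mem_qcop (compl_closure_mem_qcop_of_isOpen_closure h hU))

theorem existsUnique_minPts_of_isOpen_closure [SpectralSpace X]
    (h : ∀ U ∈ qcop t, IsOpen (closure U)) (x : X) :
    ∃! y, y ∈ minPts t ∧ specLE t y x := by
  obtain ⟨y, hy, hyx⟩ := exists_mem_minPts_specLE x
  refine ⟨y, ⟨hy, hyx⟩, fun z ⟨hz, hzx⟩ ↦ (hz y ?_).symm⟩
  refine specLE_iff_specializes.2 (specializes_iff_forall_open.2 fun O hO hzO ↦ ?_)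
  obtain ⟨U, hU, hzU, hUO⟩ := exists_qcop_subset hO hzO
  exact hUO (mem_of_mem_minPts_of_mem_closure hy hU
    (hyx.mem_of_isOpen (h U hU) (hzx.mem_closure hzU)))

theorem isSpectralMap_of_isClosed_minPts [SpectralSpace X] {m : X → X}
    (hmin : IsClosed[patchTop t] (minPts t)) (hm : ∀ x, m x ∈ minPts t ∧ specLE t (m x) x)
    (hu : ∀ x y, y ∈ minPts t → specLE t y x → y = m x) : IsSpectralMap m := by
  have hpre (S : Set X) (hS : IsClosed[patchTop t] S) : IsClosed (m ⁻¹' S) := by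
    have hS' : m ⁻¹' S = upset t (S ∩ minPts t) := by
      ext x
      exact ⟨fun hx ↦ ⟨m x, ⟨hx, (hm x).1⟩, (hm x).2⟩,
        fun ⟨k, hk, hkx⟩ ↦ mem_preimage.2 (hu x k hk.2 hkx ▸ hk.1)⟩
    rw [hS', ← closure_eq_upset (@IsClosed.inter _ _ _ (patchTop t) hS hmin)]
    exact isClosed_closure
  have hclopen (U : Set X) (hU : U ∈ qcop t) : IsClopen (m ⁻¹' U) := by
    refine ⟨hpre U (isClosed_patchTop_of_mem_qcop hU), isClosed_compl_iff.1 ?_⟩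
    rw [← preimage_compl]
    exact hpre _ ((@isClosed_compl_iff X (patchTop t) U).2 (isOpen_patchTop_of_mem_qcop hU))
  have hb : TopologicalSpace.IsTopologicalBasis (qcop t) :=
    PrespectralSpace.isTopologicalBasis
  exact ⟨hb.continuous_iff.2 fun U hU ↦ (hclopen U hU).2,
    fun U hU hU' ↦ (hclopen U ⟨hU, hU'⟩).1.isCompact⟩

theorem isOpen_closure_of_retraction [SpectralSpace X] {r : X → minPts t} (hr : Continuous r)
    (hrm : ∀ y : minPts t, r (y : X) = y) {U : Set X} (hU : U ∈ qcop t) :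
    IsOpen (closure U) := by
  have hle (x : X) : specLE t (r x) x := by
    obtain ⟨y, hy, hyx⟩ := exists_mem_minPts_specLE x
    have h : specLE t (r y : X) (r x) := specLE_iff_specializes.2
      ((specLE_iff_specializes.1 hyx).map (continuous_subtype_val.comp hr))
    have hyr : (r y : X) = r x := (r x).2 _ h
    rw [← hyr, hrm ⟨y, hy⟩]
    exact hyx
  have hclopen : IsClopen (Subtype.val ⁻¹' U : Set (minPts t)) := by
    have heq : (Subtype.val ⁻¹' U : Set (minPts t)) = Subtype.val ⁻¹' closure U := by
      ext x
      exact ⟨fun hx ↦ subset_closure hx, mem_of_mem_minPts_of_mem_closure x.2 hU⟩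
    refine ⟨?_, hU.1.preimage continuous_subtype_val⟩
    rw [heq]
    exact isClosed_closure.preimage continuous_subtype_val
  have hcl : closure U = r ⁻¹' (Subtype.val ⁻¹' U) :=
    Subset.antisymm
      (closure_minimal (fun x hx ↦ (hle x).mem_of_isOpen hU.1 hx) (hclopen.1.preimage hr))
      fun x hx ↦ (hle x).mem_closure hx
  rw [hcl]
  exact hclopen.2.preimage hr

end PCF

/-- For a spectral space `X`, TFAE: (i) `qcop X` is a Stone algebra;
(ii) closures of compact opens are open; (iii) `X^min` is patch closed and any two
generalizations of a common point have a common generalization; (iv) `X^min` is patch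
closed and every point has a unique minimal generalization; (v) every point has a unique
minimal generalization and the resulting map is spectral; (vi) there is a continuous
retraction of `X` onto `X^min`. -/
theorem statement_2 {X : Type*} [t : TopologicalSpace X] (hX : IsSpectral t) :
    List.TFAE
      [ StoneAlgebra (qcop t),
        ∀ U ∈ qcop t, IsOpen (closure U),
        IsClosed[patchTop t] (minPts t) ∧
          ∀ x y z : X, specLE t y x → specLE t z x → ∃ u, specLE t u y ∧ specLE t u z,
        IsClosed[patchTop t] (minPts t) ∧
          ∀ x : X, ∃! y, y ∈ minPts t ∧ specLE t y x,
        ∃ m : X → X, (∀ x, m x ∈ minPts t ∧ specLE t (m x) x) ∧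
          (∀ x y, y ∈ minPts t → specLE t y x → y = m x) ∧ IsSpectralMap m,
        ∃ r : X → minPts t, Continuous r ∧ ∀ y : minPts t, r (y : X) = y ] := by
  have := hX.spectralSpace
  tfae_have 1 → 2 := fun h _ hU ↦ h.isOpen_closure hU
  tfae_have 2 → 1 := fun h ↦ stoneAlgebra_of_isOpen_closure h
  tfae_have 2 → 4 := fun h ↦
    ⟨isClosed_minPts_of_isOpen_closure h, existsUnique_minPts_of_isOpen_closure h⟩
  tfae_have 3 → 4 := by
    refine fun ⟨hmin, h⟩ ↦ ⟨hmin, fun x ↦ ?_⟩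
    obtain ⟨y, hy, hyx⟩ := exists_mem_minPts_specLE x
    refine ⟨y, ⟨hy, hyx⟩, fun z ⟨hz, hzx⟩ ↦ ?_⟩
    obtain ⟨u, huy, huz⟩ := h x y z hyx hzx
    exact (hz u huz).symm.trans (hy u huy)
  tfae_have 4 → 3 := by
    refine fun ⟨hmin, h⟩ ↦ ⟨hmin, fun x y z hyx hzx ↦ ?_⟩
    obtain ⟨u, hu, huy⟩ := exists_mem_minPts_specLE y
    obtain ⟨v, hv, hvz⟩ := exists_mem_minPts_specLE z
    have huv := (h x).unique ⟨hu, specLE_trans huy hyx⟩ ⟨hv, specLE_trans hvz hzx⟩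
    exact ⟨u, huy, huv ▸ hvz⟩
  tfae_have 4 → 5 := by
    refine fun ⟨hmin, h⟩ ↦ ?_
    choose m hm hu using h
    have hu' (x y : X) (hy : y ∈ minPts t) (hyx : specLE t y x) : y = m x := hu x y ⟨hy, hyx⟩
    exact ⟨m, hm, hu', isSpectralMap_of_isClosed_minPts hmin hm hu'⟩
  tfae_have 5 → 6 := fun ⟨m, hm, hu, hspec⟩ ↦
    ⟨fun x ↦ ⟨m x, (hm x).1⟩, hspec.continuous.subtype_mk _,
      fun y ↦ Subtype.ext (y.2 _ (hm y).2)⟩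
  tfae_have 6 → 2 := fun ⟨_, hr, hrm⟩ _ hU ↦ isOpen_closure_of_retraction hr hrm hU
  tfae_finish
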